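/- Let k be a smooth null vector field for the flat metric η on ℝⁿ (η(k,k)=0) and g = η - 2H k⊗k the Kerr-Schild metric. Then the quantity g(∇^g_k k, ·) restricted to vectors orthogonal to k agrees with η(∇^η_k k, ·) restricted to the same space; in particular k is geodesic (∇_k k ∝ k) with respect to g if and only if it is geodesic with respect to η. -/

import Mathlib

open Matrix

/-- The derivative of a Kerr-Schild perturbation `c - φ l ⊗ l` of a constant metric, contracted with
the null vector field that is dual to `l` for the constant diagonal metric `s`, vanishes. -/
lemma sum_fderiv_kerrSchild_mul_eq_zero {E ι : Type*} [NormedAddCommGroup E] [NormedSpace ℝ E]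
    [Fintype ι] (s : ι → ℝ) (φ : E → ℝ) (k : E → ι → ℝ) (x w : E)
    (hφ : DifferentiableAt ℝ φ x) (hk : ∀ a, DifferentiableAt ℝ (fun y => k y a) x)
    (hnull : ∀ y, ∑ a, s a * (k y a * k y a) = 0) (c : ι → ℝ) (d : ι) :
    ∑ a, fderiv ℝ (fun y => c a - φ y * ((s d * k y d) * (s a * k y a))) x w * k x a = 0 := by
  have h_orth : ∑ a, s a * (k x a * fderiv ℝ (fun y => k y a) x w) = 0 := by
    have h_deriv : HasFDerivAt (fun y => ∑ a, s a * (k y a * k y a)) _ x :=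
      HasFDerivAt.fun_sum fun a _ =>
        (((hk a).hasFDerivAt.mul (hk a).hasFDerivAt).const_mul (s a))
    have h_zero := congrArg (fun L => L w)
      (h_deriv.unique (by simpa only [hnull] using hasFDerivAt_const (0 : ℝ) x))
    simp only [_root_.sum_apply, FunLike.coe_smul, FunLike.coe_add,
      Pi.smul_apply, Pi.add_apply, smul_eq_mul, FunLike.coe_zero, Pi.zero_apply] at h_zero
    have h_two : 2 * ∑ a, s a * (k x a * fderiv ℝ (fun y => k y a) x w) = 0 := by
      rw [← h_zero, Finset.mul_sum]
      exact Finset.sum_congr rfl fun a _ => by ring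
    linarith
  have h_term : ∀ a,
      fderiv ℝ (fun y => c a - φ y * ((s d * k y d) * (s a * k y a))) x w * k x a =
        -(φ x * (s d * k x d)) * (s a * (k x a * fderiv ℝ (fun y => k y a) x w)) +
        -(φ x * (s d * fderiv ℝ (fun y => k y d) x w) + fderiv ℝ φ x w * (s d * k x d)) *
          (s a * (k x a * k x a)) := by
    intro a
    have h_deriv := (hφ.hasFDerivAt.mul (((hk d).hasFDerivAt.const_mul (s d)).mul
      ((hk a).hasFDerivAt.const_mul (s a)))).const_sub (c a)
    have h_eq : fderiv ℝ (fun y => c a - φ y * ((s d * k y d) * (s a * k y a))) x = _ :=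
      h_deriv.fderiv
    rw [h_eq]
    simp only [FunLike.coe_smul, FunLike.coe_add, FunLike.coe_neg, Pi.neg_apply, Pi.mul_apply,
      Pi.smul_apply, Pi.add_apply, smul_eq_mul]
    ring
  simp only [h_term, Finset.sum_add_distrib, ← Finset.mul_sum, h_orth, hnull, mul_zero, add_zero]

/-- Kerr-Schild geodesic inheritance. On `ℝⁿ` with the flat
Minkowski metric `η` and the Kerr-Schild metric `g = η - 2H k♭⊗k♭`
(with inverse `g⁻¹ = η⁻¹ + 2H k⊗k`), for a smooth η-null vector field `k`:
the `g`-covariant acceleration `∇ᵍ_k k` and the flat acceleration `∇ᵉ_k k`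
have equal inner products with every vector orthogonal to `k`, and
`k` is geodesic (`∇_k k ∝ k`) w.r.t. `g` iff it is geodesic w.r.t. `η`. -/
theorem kerrSchild_geodesic_inheritance {n : ℕ}
    (η : Matrix (Fin n) (Fin n) ℝ)
    (hη : η = Matrix.diagonal (fun i : Fin n => if (i : ℕ) = 0 then (-1 : ℝ) else 1))
    (H : (Fin n → ℝ) → ℝ) (hH : ContDiff ℝ (⊤ : ℕ∞) H)
    (k : (Fin n → ℝ) → Fin n → ℝ) (hk : ∀ a, ContDiff ℝ (⊤ : ℕ∞) (fun x => k x a))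
    (hnull : ∀ x, (k x) ⬝ᵥ (η *ᵥ k x) = 0)
    (g ginv : (Fin n → ℝ) → Matrix (Fin n) (Fin n) ℝ)
    (hg : ∀ x, g x = η - (2 * H x) • vecMulVec (η *ᵥ k x) (η *ᵥ k x))
    (hginv : ∀ x, ginv x = η + (2 * H x) • vecMulVec (k x) (k x))
    -- the flat covariant derivative `(∇ᵉ_k k)ᵃ = kᵇ ∂_b kᵃ`
    (Dηkk : (Fin n → ℝ) → Fin n → ℝ)
    (hDη : ∀ x a, Dηkk x a = ∑ b, k x b * fderiv ℝ (fun y => k y a) x (Pi.single b 1))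
    -- Christoffel symbols of `g`
    (Γ : (Fin n → ℝ) → Fin n → Fin n → Fin n → ℝ)
    (hΓ : ∀ x a b c, Γ x a b c = (1 / 2) * ∑ d, ginv x a d *
        (fderiv ℝ (fun y => g y d c) x (Pi.single b 1)
          + fderiv ℝ (fun y => g y b d) x (Pi.single c 1)
          - fderiv ℝ (fun y => g y b c) x (Pi.single d 1)))
    -- the `g`-covariant derivative `(∇ᵍ_k k)ᵃ = kᵇ ∂_b kᵃ + Γᵃ_{bc} kᵇ kᶜ`
    (Dgkk : (Fin n → ℝ) → Fin n → ℝ)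
    (hDg : ∀ x a, Dgkk x a = Dηkk x a + ∑ b, ∑ c, Γ x a b c * k x b * k x c) :
    (∀ x, ∀ v : Fin n → ℝ, v ⬝ᵥ (η *ᵥ k x) = 0 →
        v ⬝ᵥ (g x *ᵥ Dgkk x) = v ⬝ᵥ (η *ᵥ Dηkk x)) ∧
    ((∃ f : (Fin n → ℝ) → ℝ, ∀ x, Dgkk x = f x • k x) ↔
      (∃ f : (Fin n → ℝ) → ℝ, ∀ x, Dηkk x = f x • k x)) := by
  set s : Fin n → ℝ := fun i => if (i : ℕ) = 0 then (-1 : ℝ) else 1 with hs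
  have h_entry : ∀ d c, (fun y => g y d c) =
      fun y => η d c - (2 * H y) * ((s d * k y d) * (s c * k y c)) := by
    intro d c
    funext y
    simp [hg, hη, vecMulVec_apply, mulVec_diagonal]
  have h_null : ∀ y, ∑ a, s a * (k y a * k y a) = 0 := by
    intro y
    rw [← hnull y, hη]
    simp only [dotProduct, mulVec_diagonal]
    exact Finset.sum_congr rfl fun a _ => by ring
  have h_contract : ∀ x w d, ∑ c, fderiv ℝ (fun y => g y d c) x w * k x c = 0 := by
    intro x w d
    simp only [h_entry]
    exact sum_fderiv_kerrSchild_mul_eq_zero s (fun y => 2 * H y) k x w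
      ((hH.differentiable (by simp)).const_mul 2 x)
      (fun a => (hk a).differentiable (by simp) x) h_null (η d) d
  have h_symm : ∀ b d, (fun y => g y b d) = fun y => g y d b := by
    intro b d
    have h_eta : η b d = η d b := by
      rw [hη, ← Matrix.diagonal_transpose, Matrix.transpose_apply, Matrix.diagonal_transpose]
    rw [h_entry, h_entry, h_eta]
    funext y
    ring
  have h_christoffel : ∀ x a, ∑ b, ∑ c, Γ x a b c * k x b * k x c = 0 := by
    intro x a
    have h_expand : ∀ b c, Γ x a b c * k x b * k x c = ∑ d, (1 / 2) * ginv x a d *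
        (k x b * (fderiv ℝ (fun y => g y d c) x (Pi.single b 1) * k x c)
          + k x c * (fderiv ℝ (fun y => g y d b) x (Pi.single c 1) * k x b)
          - k x b * (fderiv ℝ (fun y => g y b c) x (Pi.single d 1) * k x c)) := by
      intro b c
      rw [hΓ, Finset.mul_sum, Finset.sum_mul, Finset.sum_mul]
      refine Finset.sum_congr rfl fun d _ => ?_
      rw [h_symm b d]
      ring
    have h_swap : ∀ d, ∑ b, ∑ c,
        k x c * (fderiv ℝ (fun y => g y d b) x (Pi.single c 1) * k x b) = 0 := by
      intro d
      rw [Finset.sum_comm]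
      simp only [← Finset.mul_sum, h_contract, mul_zero, Finset.sum_const_zero]
    simp only [h_expand]
    rw [Finset.sum_congr rfl fun b _ => Finset.sum_comm, Finset.sum_comm]
    refine Finset.sum_eq_zero fun d _ => ?_
    simp only [← Finset.mul_sum, Finset.sum_add_distrib, Finset.sum_sub_distrib, h_swap]
    simp only [h_contract, mul_zero, Finset.sum_const_zero, add_zero, sub_zero]
  have h_eq : Dgkk = Dηkk := by
    funext x a
    rw [hDg, h_christoffel, add_zero]
  subst h_eq
  refine ⟨fun x v hv => ?_, Iff.rfl⟩
  rw [hg, sub_mulVec, smul_mulVec, vecMulVec_mulVec, dotProduct_sub, dotProduct_smul]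
  simp [hv]
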